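/- For any bicolouring of the once-punctured convex m-gon P*_m (m ≥ 2), there is an enumeration T_1, …, T_N of all permissible triangulations of P*_m such that for all indices 1 ≤ j < k ≤ N there exists i < k with |T_i ∩ T_k| = m−2 and T_j ∩ T_k ⊆ T_i ∩ T_k. (The complex of permitted arcs satisfies Wilson's shelling property.) -/

import Mathlib

/-!
Vertices of the once-punctured convex `m`-gon `P*_m` are identified with `ZMod m`.
An arc is an equivalence class `[(a,b)]` of pairs of integers with
`a < b ≤ a + m` and `b - a ≥ 2`, modulo `(a,b) ∼ (a+m, b+m)`.  Each class has a unique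
representative with `0 ≤ a < m`; we identify arcs with these canonical representatives,
i.e. with pairs `p : ℤ × ℤ` satisfying `IsPArc m p` below.
Blue is encoded by the Boolean value `true`, red by `false`.
-/

namespace Punc

/-- `p` is (the canonical representative of) an arc of `P*_m`:
`0 ≤ p.1 < m`, `p.1 < p.2 ≤ p.1 + m` and `p.2 - p.1 ≥ 2`. -/
def IsPArc (m : ℕ) (p : ℤ × ℤ) : Prop :=
  0 ≤ p.1 ∧ p.1 < (m : ℤ) ∧ p.1 + 2 ≤ p.2 ∧ p.2 ≤ p.1 + (m : ℤ)

/-- The arcs `[(a,b)] = p` and `[(c,d)] = q` cross: there is an integer `k` with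
`a + km < c < b + km < d` or with `c < a + km < d < b + km`. -/
def PCross (m : ℕ) (p q : ℤ × ℤ) : Prop :=
  ∃ k : ℤ, (p.1 + k * m < q.1 ∧ q.1 < p.2 + k * m ∧ p.2 + k * m < q.2) ∨
    (q.1 < p.1 + k * m ∧ p.1 + k * m < q.2 ∧ q.2 < p.2 + k * m)

/-- The arc `p` is the maximal arc based at `p.1 mod m`, i.e. `p.2 - p.1 = m`. -/
def IsMaximalArc (m : ℕ) (p : ℤ × ℤ) : Prop :=
  IsPArc m p ∧ p.2 - p.1 = (m : ℤ)

/-- A triangulation of `P*_m`: a set of `m - 1` pairwise non-crossing arcs. -/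
def IsPTriangulation (m : ℕ) (T : Finset (ℤ × ℤ)) : Prop :=
  T.card = m - 1 ∧ (∀ p ∈ T, IsPArc m p) ∧
    ∀ p ∈ T, ∀ q ∈ T, p ≠ q → ¬ PCross m p q

/-- A bicolouring: a function from the vertices to {red, blue} attaining both values
(`true` = blue, `false` = red). -/
def IsBicolouring (m : ℕ) (c : ZMod m → Bool) : Prop :=
  (∃ v, c v = true) ∧ (∃ v, c v = false)

/-- A bicolouring is non-trivial if some arc has both endpoints red. -/
def IsNontrivialBicolouring (m : ℕ) (c : ZMod m → Bool) : Prop :=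
  IsBicolouring m c ∧
    ∃ p : ℤ × ℤ, IsPArc m p ∧ c (p.1 : ZMod m) = false ∧ c (p.2 : ZMod m) = false

/-- An arc is permitted if at least one of its endpoints is blue. -/
def Permitted (m : ℕ) (c : ZMod m → Bool) (p : ℤ × ℤ) : Prop :=
  c (p.1 : ZMod m) = true ∨ c (p.2 : ZMod m) = true

/-- A permissible triangulation: a triangulation all of whose arcs are permitted. -/
def IsPermissible (m : ℕ) (c : ZMod m → Bool) (T : Finset (ℤ × ℤ)) : Prop :=
  IsPTriangulation m T ∧ ∀ p ∈ T, Permitted m c p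

/-- Two permissible triangulations are joined in the flip graph of permissible
triangulations: there is a finite sequence of permissible triangulations from one to the
other in which consecutive triangulations share exactly `m - 2` arcs. -/
def PermFlipJoined (m : ℕ) (c : ZMod m → Bool) (T₁ T₂ : Finset (ℤ × ℤ)) : Prop :=
  ∃ n : ℕ, ∃ f : Fin (n + 1) → Finset (ℤ × ℤ),
    f 0 = T₁ ∧ f (Fin.last n) = T₂ ∧ (∀ i, IsPermissible m c (f i)) ∧
    ∀ i : Fin n, (f i.castSucc ∩ f i.succ).card = m - 2


/-- The representative of an arc whose first coordinate lies in `[0, m)`. -/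
def canon (m : ℕ) (p : ℤ × ℤ) : ℤ × ℤ := (p.1 - p.1 / m * m, p.2 - p.1 / m * m)

/-- The pair `(a, b)` represents an arc of `T`. -/
def Lift (m : ℕ) (T : Finset (ℤ × ℤ)) (a b : ℤ) : Prop := canon m (a, b) ∈ T

/-- The pair `(a, b)` represents an arc of `T` or a boundary edge. -/
def Edge (m : ℕ) (T : Finset (ℤ × ℤ)) (a b : ℤ) : Prop := b = a + 1 ∨ Lift m T a b

section Lifts

variable {m : ℕ} {T : Finset (ℤ × ℤ)}

theorem canon_add (hm : 2 ≤ m) (a b k : ℤ) :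
    canon m (a + k * m, b + k * m) = canon m (a, b) := by
  have h : (m : ℤ) ≠ 0 := by omega
  simp only [canon, Int.add_mul_ediv_right _ _ h, Prod.mk.injEq]
  constructor <;> ring

theorem canon_of_isPArc {p : ℤ × ℤ} (hp : IsPArc m p) : canon m p = p := by
  obtain ⟨h0, h1, -, -⟩ := hp
  simp [canon, Int.ediv_eq_zero_of_lt h0 h1]

theorem isPArc_canon (hm : 2 ≤ m) {a b : ℤ} (h : a + 2 ≤ b) (h' : b ≤ a + m) :
    IsPArc m (canon m (a, b)) := by
  have h1 := Int.emod_nonneg a (b := m) (by omega)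
  have h2 := Int.emod_lt_of_pos a (b := m) (by omega)
  have h3 := Int.mul_ediv_add_emod a m
  rw [mul_comm] at h3
  simp only [IsPArc, canon]
  omega

theorem canon_eq_iff (hm : 2 ≤ m) {a b c d : ℤ} :
    canon m (a, b) = canon m (c, d) ↔ ∃ k : ℤ, c = a + k * m ∧ d = b + k * m := by
  constructor
  · intro h
    simp only [canon, Prod.mk.injEq] at h
    refine ⟨c / m - a / m, ?_, ?_⟩ <;> rw [sub_mul] <;> omega
  · rintro ⟨k, rfl, rfl⟩
    exact (canon_add hm a b k).symm

theorem lift_add (hm : 2 ≤ m) {a b : ℤ} (k : ℤ) :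
    Lift m T (a + k * m) (b + k * m) ↔ Lift m T a b := by
  simp only [Lift, canon_add hm]

theorem edge_add (hm : 2 ≤ m) {a b : ℤ} (k : ℤ) :
    Edge m T (a + k * m) (b + k * m) ↔ Edge m T a b := by
  simp only [Edge, lift_add hm]
  constructor <;> rintro (h | h) <;> first | exact Or.inr h | (left; omega)

theorem Lift.of_eq {a b c d : ℤ} (h : Lift m T a b) (hc : c = a) (hd : d = b) :
    Lift m T c d := by
  subst hc hd; exact h

theorem Edge.lift {a b : ℤ} (h : Edge m T a b) (hab : a + 2 ≤ b) : Lift m T a b := by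
  rcases h with h | h
  · omega
  · exact h

theorem lift_of_mem (h : IsPTriangulation m T) {p : ℤ × ℤ} (hp : p ∈ T) :
    Lift m T p.1 p.2 := by
  rw [Lift, Prod.mk.eta, canon_of_isPArc (h.2.1 p hp)]
  exact hp

theorem IsPTriangulation.len (h : IsPTriangulation m T) {a b : ℤ} (hl : Lift m T a b) :
    a + 2 ≤ b ∧ b ≤ a + m := by
  obtain ⟨-, -, h3, h4⟩ := h.2.1 _ hl
  simp only [canon] at h3 h4
  omega

theorem IsPTriangulation.noncrossing (h : IsPTriangulation m T) (hm : 2 ≤ m) {a b c d : ℤ}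
    (hab : Lift m T a b) (hcd : Lift m T c d) (h1 : a < c) (h2 : c < b) (h3 : b < d) : False := by
  by_cases he : canon m (a, b) = canon m (c, d)
  · obtain ⟨k, hk, -⟩ := (canon_eq_iff hm).1 he
    have hl := h.len hab
    have hk0 : 0 < k := by
      by_contra hk0
      have := mul_nonpos_of_nonpos_of_nonneg (not_lt.1 hk0) (Int.natCast_nonneg m)
      omega
    have := le_mul_of_one_le_left (Int.natCast_nonneg m) hk0
    omega
  · refine h.2.2 _ hab _ hcd he ⟨a / m - c / m, Or.inl ?_⟩
    simp only [canon, sub_mul]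
    omega

theorem IsPTriangulation.edge_noncrossing (h : IsPTriangulation m T) (hm : 2 ≤ m) {a b c d : ℤ}
    (hab : Edge m T a b) (hcd : Edge m T c d) (h1 : a < c) (h2 : c < b) (h3 : b < d) : False :=
  h.noncrossing hm (hab.lift (by omega)) (hcd.lift (by omega)) h1 h2 h3

/-- `c` is the last vertex before `b` that is joined to `a` by an edge `(a, c)`. -/
def LeftApex (m : ℕ) (T : Finset (ℤ × ℤ)) (a b c : ℤ) : Prop :=
  a < c ∧ c < b ∧ Edge m T a c ∧ ∀ c', c < c' → c' < b → ¬ Edge m T a c'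

theorem exists_leftApex {a b : ℤ} (hab : a + 2 ≤ b) : ∃ c, LeftApex m T a b c := by
  obtain ⟨c, ⟨h1, h2, h3⟩, h4⟩ := Int.exists_greatest_of_bdd
    (P := fun c => a < c ∧ c < b ∧ Edge m T a c) ⟨b, fun z hz => by omega⟩
    ⟨a + 1, by omega, by omega, Or.inl rfl⟩
  exact ⟨c, h1, h2, h3, fun c' hc hb he => by
    have := h4 c' ⟨by omega, hb, he⟩
    omega⟩

theorem LeftApex.unique_arc (h : IsPTriangulation m T) (hm : 2 ≤ m) {a b a' b' c : ℤ}
    (hab : Lift m T a b) (hab' : Lift m T a' b')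
    (hc : LeftApex m T a b c) (hc' : LeftApex m T a' b' c) : a = a' ∧ b = b' := by
  obtain ⟨h1, h2, h3, h4⟩ := hc
  obtain ⟨h1', h2', h3', h4'⟩ := hc'
  have e : a = a' := by
    rcases lt_trichotomy a a' with hlt | he | hlt
    · exact (h.edge_noncrossing hm h3 (Or.inr hab') hlt h1' h2').elim
    · exact he
    · exact (h.edge_noncrossing hm h3' (Or.inr hab) hlt h1 h2).elim
  subst e
  refine ⟨rfl, ?_⟩
  rcases lt_trichotomy b b' with hlt | he | hlt
  · exact (h4' b h2 hlt (Or.inr hab)).elim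
  · exact he
  · exact (h4 b' h2' hlt (Or.inr hab')).elim

theorem leftApex_add (hm : 2 ≤ m) {a b c : ℤ} (k : ℤ) (hc : LeftApex m T a b c) :
    LeftApex m T (a + k * m) (b + k * m) (c + k * m) := by
  obtain ⟨h1, h2, h3, h4⟩ := hc
  refine ⟨by omega, by omega, (edge_add hm k).2 h3, fun c' hc hb he => ?_⟩
  refine h4 (c' - k * m) (by omega) (by omega) ((edge_add hm k).1 ?_)
  rwa [sub_add_cancel]

/-- At most one residue is not the left apex of an arc of a triangulation. -/
theorem IsPTriangulation.dvd_sub_of_forall_not_leftApex (h : IsPTriangulation m T) (hm : 2 ≤ m)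
    {u v : ℤ}
    (hu : ∀ a b, Lift m T a b → ¬ LeftApex m T a b u)
    (hv : ∀ a b, Lift m T a b → ¬ LeftApex m T a b v) : (m : ℤ) ∣ v - u := by
  have : NeZero m := ⟨by omega⟩
  have key : ∀ p : ℤ × ℤ, ∃ c, p ∈ T → LeftApex m T p.1 p.2 c := fun p => by
    by_cases hp : p ∈ T
    · obtain ⟨c, hc⟩ := exists_leftApex (m := m) (T := T) (h.2.1 p hp).2.2.1
      exact ⟨c, fun _ => hc⟩
    · exact ⟨0, fun h => (hp h).elim⟩
  choose g hg using key
  have hinj : Set.InjOn (fun p => (g p : ZMod m)) T := by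
    intro p hp q hq hpq
    obtain ⟨k, hk⟩ := (ZMod.intCast_eq_intCast_iff_dvd_sub _ _ _).1 hpq
    have h1 := leftApex_add hm k (hg p hp)
    have h2 := hg q hq
    have e : g p + k * m = g q := by rw [mul_comm]; omega
    rw [e] at h1
    obtain ⟨ha, hb⟩ := LeftApex.unique_arc h hm ((lift_add hm k).2 (lift_of_mem h hp))
      (lift_of_mem h hq) h1 h2
    rw [← canon_of_isPArc (h.2.1 p hp), ← canon_of_isPArc (h.2.1 q hq)]
    exact (canon_eq_iff hm).2 ⟨k, ha.symm, hb.symm⟩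
  have hcard : (T.image fun p => (g p : ZMod m)).card = m - 1 := by
    rw [Finset.card_image_of_injOn hinj, h.1]
  have hcompl : ((T.image fun p => (g p : ZMod m))ᶜ).card ≤ 1 := by
    rw [Finset.card_compl, hcard, ZMod.card]
    omega
  have hmiss : ∀ u : ℤ, (∀ a b, Lift m T a b → ¬ LeftApex m T a b u) →
      (u : ZMod m) ∈ (T.image fun p => (g p : ZMod m))ᶜ := by
    intro u hu
    rw [Finset.mem_compl, Finset.mem_image]
    rintro ⟨p, hp, hpu⟩
    obtain ⟨k, hk⟩ := (ZMod.intCast_eq_intCast_iff_dvd_sub _ _ _).1 hpu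
    have h1 := leftApex_add hm k (hg p hp)
    have e : g p + k * m = u := by rw [mul_comm]; omega
    rw [e] at h1
    exact hu _ _ ((lift_add hm k).2 (lift_of_mem h hp)) h1
  exact (ZMod.intCast_eq_intCast_iff_dvd_sub _ _ _).1
    (Finset.card_le_one.1 hcompl _ (hmiss u hu) _ (hmiss v hv))

theorem IsPTriangulation.exists_maximal (h : IsPTriangulation m T) (hm : 2 ≤ m) :
    ∃ v, Lift m T v (v + m) := by
  have hne : T.Nonempty := by rw [← Finset.card_pos, h.1]; omega
  obtain ⟨p, hp, hmax⟩ := T.exists_max_image (fun p => p.2 - p.1) hne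
  have hl := lift_of_mem h hp
  have hlen := h.len hl
  have hmax' : ∀ a b, Lift m T a b → b - a ≤ p.2 - p.1 := by
    intro a b hab
    have := hmax _ hab
    simp only [canon] at this
    omega
  have hd : (m : ℤ) ∣ p.2 - p.1 := by
    refine h.dvd_sub_of_forall_not_leftApex hm ?_ ?_ <;> rintro a b hab ⟨h1, h2, -, -⟩ <;>
      have := hmax' a b hab
    · exact h.noncrossing hm hab hl h1 h2 (by omega)
    · exact h.noncrossing hm hl hab (by omega) h1 h2
  have := Int.le_of_dvd (by omega) hd
  exact ⟨p.1, hl.of_eq rfl (by omega)⟩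

theorem IsPTriangulation.maximal_noncrossing (h : IsPTriangulation m T) (hm : 2 ≤ m)
    {v a b : ℤ} (hv : Lift m T v (v + m)) (hab : Lift m T a b) (h1 : a < v) (h2 : v < b) :
    False := by
  have := h.len hab
  exact h.noncrossing hm hab hv h1 h2 (by omega)

/-- Every arc is a side of a triangle lying on the side of the arc away from the puncture. -/
theorem IsPTriangulation.exists_apex (h : IsPTriangulation m T) (hm : 2 ≤ m) {a b : ℤ}
    (hab : Lift m T a b) : ∃ c, a < c ∧ c < b ∧ Edge m T a c ∧ Edge m T c b := by
  have hlen := h.len hab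
  obtain ⟨c, h1, h2, h3, h4⟩ := exists_leftApex (m := m) (T := T) hlen.1
  obtain ⟨d, ⟨k1, k2, k3⟩, k4⟩ := Int.exists_least_of_bdd
    (P := fun d => a < d ∧ d < b ∧ Edge m T d b) ⟨a, fun z hz => by omega⟩
    ⟨b - 1, by omega, by omega, Or.inl (by omega)⟩
  rcases lt_trichotomy c d with hlt | rfl | hlt
  · exfalso
    have hd : ∀ a' b', Lift m T a' b' → ¬ LeftApex m T a' b' d := by
      rintro a' b' hab' ⟨l1, l2, l3, l4⟩
      rcases lt_trichotomy a' a with ha | rfl | ha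
      · exact h.edge_noncrossing hm l3 (Or.inr hab) ha k1 k2
      · exact h4 d hlt k2 l3
      · rcases lt_trichotomy b' b with hb | rfl | hb
        · exact h.edge_noncrossing hm (Or.inr hab') k3 l1 l2 hb
        · have := k4 a' ⟨ha, by omega, Or.inr hab'⟩
          omega
        · exact h.noncrossing hm hab hab' ha (by omega) hb
    obtain ⟨v, hv⟩ := h.exists_maximal hm
    obtain ⟨k, hk⟩ := h.dvd_sub_of_forall_not_leftApex hm
      (fun a b hab hL => h.maximal_noncrossing hm hv hab hL.1 hL.2.1) hd
    have e : d = v + k * m := by rw [mul_comm]; omega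
    have hv' := (lift_add hm k).2 hv
    exact h.maximal_noncrossing hm (v := d) (hv'.of_eq e (by rw [e]; ring)) hab k1 k2
  · exact ⟨c, h1, h2, h3, k3⟩
  · exact (h.edge_noncrossing hm h3 k3 k1 hlt h2).elim

theorem IsPTriangulation.exists_arc_of_apex (h : IsPTriangulation m T) (hm : 2 ≤ m) {v : ℤ}
    (hv : ¬ Lift m T v (v + m)) :
    ∃ a b, Lift m T a b ∧ a < v ∧ v < b ∧ Edge m T a v ∧ Edge m T v b := by
  obtain ⟨u, hu⟩ := h.exists_maximal hm
  by_cases hmiss : ∀ a b, Lift m T a b → ¬ LeftApex m T a b v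
  · obtain ⟨k, hk⟩ := h.dvd_sub_of_forall_not_leftApex hm
      (fun a b hab hL => h.maximal_noncrossing hm hu hab hL.1 hL.2.1) hmiss
    have e : v = u + k * m := by rw [mul_comm]; omega
    exact (hv (((lift_add hm k).2 hu).of_eq e (by rw [e]; ring))).elim
  · push Not at hmiss
    obtain ⟨a, b, hab, h1, h2, h3, h4⟩ := hmiss
    obtain ⟨c, k1, k2, k3, k4⟩ := h.exists_apex hm hab
    rcases lt_trichotomy c v with hlt | rfl | hlt
    · exact (h.edge_noncrossing hm h3 k4 k1 hlt h2).elim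
    · exact ⟨a, b, hab, h1, h2, h3, k4⟩
    · exact (h4 c hlt k2 k3).elim

/-- An arc that is not maximal is a side of a triangle on the side of the puncture. -/
theorem IsPTriangulation.exists_parent (h : IsPTriangulation m T) (hm : 2 ≤ m) {a b : ℤ}
    (hab : Lift m T a b) (hlt : b < a + m) :
    (∃ d, b < d ∧ Lift m T a d ∧ Edge m T b d) ∨ (∃ d, d < a ∧ Lift m T d b ∧ Edge m T d a) := by
  have hlen := h.len hab
  have hex : ∃ n : ℕ, ∃ p q, Lift m T p q ∧ p ≤ a ∧ b ≤ q ∧ b - a < q - p ∧ q - p = n := by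
    obtain ⟨v, hv⟩ := h.exists_maximal hm
    have h1 := Int.emod_nonneg (a - v) (b := m) (by omega)
    have h2 := Int.emod_lt_of_pos (a - v) (b := m) (by omega)
    have h3 := Int.mul_ediv_add_emod (a - v) m
    rw [mul_comm] at h3
    have hv' := (lift_add hm ((a - v) / m)).2 hv
    refine ⟨m, _, _, hv', by omega, ?_, by omega, by omega⟩
    by_contra hb
    rcases lt_or_eq_of_le h1 with hpos | hz
    · exact h.noncrossing hm hv' hab (by omega) (by omega) (by omega)
    · omega
  classical
  obtain ⟨p, q, hpq, hp, hq, hs, hn⟩ := Nat.find_spec hex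
  have hmin : ∀ p' q', Lift m T p' q' → p' ≤ a → b ≤ q' → b - a < q' - p' → q - p ≤ q' - p' := by
    intro p' q' hl h1 h2 h3
    have := Nat.find_min' hex (m := (q' - p').toNat) ⟨p', q', hl, h1, h2, h3, by omega⟩
    omega
  obtain ⟨c, k1, k2, k3, k4⟩ := h.exists_apex hm hpq
  rcases le_or_gt b c with hbc | hbc
  · have hl := k3.lift (by omega)
    by_cases hsm : b - a < c - p
    · have := hmin p c hl hp hbc hsm
      omega
    · obtain rfl : p = a := by omega
      obtain rfl : c = b := by omega
      exact Or.inl ⟨q, k2, hpq, k4⟩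
  · rcases le_or_gt c a with hca | hca
    · have hl := k4.lift (by omega)
      by_cases hsm : b - a < q - c
      · have := hmin c q hl hca hq hsm
        omega
      · obtain rfl : q = b := by omega
        obtain rfl : c = a := by omega
        exact Or.inr ⟨p, k1, hpq, k3⟩
    · rcases lt_or_eq_of_le hp with hlt' | rfl
      · exact (h.edge_noncrossing hm k3 (Or.inr hab) hlt' hca hbc).elim
      · exact (h.edge_noncrossing hm (Or.inr hab) k4 k1 hbc (by omega)).elim

end Lifts

/-- Replacing the arc `(a, b)` of `T` by `(c, d)` is a flip. -/
structure FlipTo (m : ℕ) (T : Finset (ℤ × ℤ)) (a b c d : ℤ) : Prop where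
  mem : Lift m T a b
  two_le : c + 2 ≤ d
  le_add : d ≤ c + m
  notMem : ¬ Lift m T c d
  cross_left : ∀ e f, Lift m T e f → e < c → c < f → f < d → canon m (e, f) = canon m (a, b)
  cross_right : ∀ e f, Lift m T e f → c < e → e < d → d < f → canon m (e, f) = canon m (a, b)

section Flips

variable {m : ℕ} {T T' : Finset (ℤ × ℤ)}

theorem PCross.symm {p q : ℤ × ℤ} (h : PCross m p q) : PCross m q p := by
  obtain ⟨k, h⟩ := h
  refine ⟨-k, ?_⟩
  rw [neg_mul]
  omega

theorem FlipTo.not_pCross (hT : IsPTriangulation m T) (hm : 2 ≤ m) {a b c d : ℤ}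
    (h : FlipTo m T a b c d) {q : ℤ × ℤ} (hq : q ∈ T.erase (canon m (a, b))) :
    ¬ PCross m (canon m (c, d)) q := by
  rintro ⟨k, hk⟩
  obtain ⟨hne, hq⟩ := Finset.mem_erase.1 hq
  have hl := lift_of_mem hT hq
  have hl' : Lift m T (q.1 + (c / m - k) * m) (q.2 + (c / m - k) * m) := (lift_add hm _).2 hl
  have key : canon m (q.1 + (c / m - k) * m, q.2 + (c / m - k) * m) = canon m (a, b) := by
    simp only [canon] at hk
    rcases hk with hk | hk
    · refine h.cross_right _ _ hl' ?_ ?_ ?_ <;> rw [sub_mul] <;> omega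
    · refine h.cross_left _ _ hl' ?_ ?_ ?_ <;> rw [sub_mul] <;> omega
  rw [canon_add hm, Prod.mk.eta, canon_of_isPArc (hT.2.1 q hq)] at key
  exact hne key

theorem FlipTo.isPTriangulation (hT : IsPTriangulation m T) (hm : 2 ≤ m) {a b c d : ℤ}
    (h : FlipTo m T a b c d) :
    IsPTriangulation m (insert (canon m (c, d)) (T.erase (canon m (a, b)))) := by
  refine ⟨?_, ?_, ?_⟩
  · rw [Finset.card_insert_of_notMem fun hh => h.notMem (Finset.mem_of_mem_erase hh),
      Finset.card_erase_of_mem h.mem, hT.1]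
    omega
  · intro p hp
    rcases Finset.mem_insert.1 hp with rfl | hp
    · exact isPArc_canon hm h.two_le h.le_add
    · exact hT.2.1 p (Finset.mem_of_mem_erase hp)
  · intro p hp q hq hpq
    rcases Finset.mem_insert.1 hp with rfl | hp
    · rcases Finset.mem_insert.1 hq with rfl | hq
      · exact (hpq rfl).elim
      · exact h.not_pCross hT hm hq
    · rcases Finset.mem_insert.1 hq with rfl | hq
      · exact fun hc => h.not_pCross hT hm hp hc.symm
      · exact hT.2.2 p (Finset.mem_of_mem_erase hp) q (Finset.mem_of_mem_erase hq) hpq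

/-- The flip in a quadrilateral `a < c < b < d` replacing `(a, b)` by `(c, d)`. -/
theorem IsPTriangulation.flipTo_right (h : IsPTriangulation m T) (hm : 2 ≤ m) {a b c d : ℤ}
    (hab : Lift m T a b) (had : Lift m T a d) (hac : Edge m T a c) (hcb : Edge m T c b)
    (hbd : Edge m T b d) (h1 : a < c) (h2 : c < b) (h3 : b < d) : FlipTo m T a b c d := by
  have hlen := h.len had
  refine ⟨hab, by omega, by omega, fun hcd => h.noncrossing hm hab hcd h1 h2 h3, ?_, ?_⟩
  · intro e f hef k1 k2 k3
    have e1 := h.edge_noncrossing hm (Or.inr hef) (Or.inr had)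
    have e2 := h.edge_noncrossing hm hac (Or.inr hef)
    have e3 := h.edge_noncrossing hm (Or.inr hef) hcb
    have e4 := h.edge_noncrossing hm (Or.inr hef) hbd
    obtain rfl : e = a := by
      rcases lt_trichotomy e a with hlt | he | hlt
      · exact (e1 hlt (by omega) k3).elim
      · exact he
      · exact (e2 hlt k1 k2).elim
    obtain rfl : f = b := by
      rcases lt_trichotomy f b with hlt | he | hlt
      · exact (e3 k1 k2 hlt).elim
      · exact he
      · exact (e4 (by omega) hlt k3).elim
    rfl
  · intro e f hef k1 k2 k3
    exact (h.noncrossing hm had hef (by omega) k2 k3).elim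

/-- The flip in a quadrilateral `a < c < b < d` replacing `(c, d)` by `(a, b)`. -/
theorem IsPTriangulation.flipTo_left (h : IsPTriangulation m T) (hm : 2 ≤ m) {a b c d : ℤ}
    (hcd : Lift m T c d) (had : Lift m T a d) (hac : Edge m T a c) (hcb : Edge m T c b)
    (hbd : Edge m T b d) (h1 : a < c) (h2 : c < b) (h3 : b < d) : FlipTo m T c d a b := by
  have hlen := h.len had
  refine ⟨hcd, by omega, by omega, fun hab => h.noncrossing hm hab hcd h1 h2 h3, ?_, ?_⟩
  · intro e f hef k1 k2 k3
    exact (h.noncrossing hm hef had k1 k2 (by omega)).elim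
  · intro e f hef k1 k2 k3
    have e1 := h.edge_noncrossing hm (Or.inr had) (Or.inr hef)
    have e2 := h.edge_noncrossing hm hac (Or.inr hef)
    have e3 := h.edge_noncrossing hm hcb (Or.inr hef)
    have e4 := h.edge_noncrossing hm (Or.inr hef) hbd
    obtain rfl : f = d := by
      rcases lt_trichotomy f d with hlt | he | hlt
      · exact (e4 k2 k3 hlt).elim
      · exact he
      · exact (e1 k1 (by omega) hlt).elim
    obtain rfl : e = c := by
      rcases lt_trichotomy e c with hlt | he | hlt
      · exact (e2 k1 hlt (by omega)).elim
      · exact he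
      · exact (e3 hlt k2 k3).elim
    rfl

/-- The flip replacing the maximal arc at `a` by the maximal arc at `c`. -/
theorem IsPTriangulation.flipTo_maximal (h : IsPTriangulation m T) (hm : 2 ≤ m) {a c : ℤ}
    (ha : Lift m T a (a + m)) (hac : Edge m T a c) (hca : Edge m T c (a + m))
    (h1 : a < c) (h2 : c < a + m) : FlipTo m T a (a + m) c (c + m) := by
  have key : ∀ e f, Lift m T e f → e < c → c < f → e = a ∧ f = a + m := by
    intro e f hef k1 k2
    have hlen := h.len hef
    have e1 := h.edge_noncrossing hm hac (Or.inr hef)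
    have e2 := h.edge_noncrossing hm (Or.inr hef) hca
    have e3 := h.edge_noncrossing hm (Or.inr hef) (Or.inr ha)
    have e4 := h.edge_noncrossing hm (Or.inr ha) (Or.inr hef)
    rcases lt_trichotomy e a with hlt | he | hlt
    · exact (e3 hlt (by omega) (by omega)).elim
    · refine ⟨he, ?_⟩
      rcases lt_trichotomy f (a + m) with hlt | he | hlt
      · exact (e2 k1 k2 hlt).elim
      · exact he
      · omega
    · exact (e1 hlt k1 k2).elim
  refine ⟨ha, by omega, by omega, fun hc => h.noncrossing hm ha hc h1 h2 (by omega), ?_, ?_⟩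
  · intro e f hef k1 k2 k3
    obtain ⟨rfl, rfl⟩ := key e f hef k1 k2
    rfl
  · intro e f hef k1 k2 k3
    have hlen := h.len hef
    obtain ⟨he, hf⟩ := key _ _ ((lift_add hm (-1)).2 hef) (by omega) (by omega)
    exact (canon_eq_iff hm).2 ⟨-1, by omega, by omega⟩

theorem intCast_ne_of_lt {a b : ℤ} (h1 : a < b) (h2 : b < a + m) : (a : ZMod m) ≠ b := by
  intro h
  have := Int.le_of_dvd (by omega) ((ZMod.intCast_eq_intCast_iff_dvd_sub _ _ _).1 h)
  omega

/-- Every arc can be flipped, to an arc that ends at the apex of the triangle below it. -/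
theorem IsPTriangulation.exists_flipTo_of_apex (h : IsPTriangulation m T) (hm : 2 ≤ m)
    {a b v : ℤ} (hab : Lift m T a b) (h1 : a < v) (h2 : v < b) (hav : Edge m T a v)
    (hvb : Edge m T v b) :
    ∃ e f : ℤ, FlipTo m T a b e f ∧ ((e : ZMod m) = v ∨ (f : ZMod m) = v) := by
  have hlen := h.len hab
  rcases lt_or_eq_of_le hlen.2 with hlt | rfl
  · rcases h.exists_parent hm hab hlt with ⟨d, h3, had, hbd⟩ | ⟨d, h3, hdb, hda⟩
    · exact ⟨v, d, h.flipTo_right hm hab had hav hvb hbd h1 h2 h3, Or.inl rfl⟩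
    · exact ⟨d, v, h.flipTo_left hm hab hdb hda hav hvb h3 h1 h2, Or.inr rfl⟩
  · exact ⟨v, v + m, h.flipTo_maximal hm hab hav hvb h1 h2, Or.inl rfl⟩

/-- A flip of `T` that removes an arc not in `T'`. -/
def DiffFlip (m : ℕ) (T T' : Finset (ℤ × ℤ)) (a b e f : ℤ) : Prop :=
  FlipTo m T a b e f ∧ ¬ Lift m T' a b

/-- The exchange of `(a, b)` for `(e, f)` creates an arc at `v`, or turns an arc ending at `v`
into one starting at `v`. -/
def Gains (m : ℕ) (v : ZMod m) (a b e f : ℤ) : Prop :=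
  ((e : ZMod m) = v ∨ (f : ZMod m) = v) ∧ (a : ZMod m) ≠ v ∧
    ((b : ZMod m) ≠ v ∨ (e : ZMod m) = v)

theorem exists_gain_of_apex (hT : IsPTriangulation m T) (hm : 2 ≤ m) {a b v : ℤ}
    (hab : Lift m T a b) (hab' : ¬ Lift m T' a b) (h1 : a < v) (h2 : v < b) (hav : Edge m T a v)
    (hvb : Edge m T v b) : ∃ a b e f : ℤ, DiffFlip m T T' a b e f ∧ Gains m v a b e f := by
  have hlen := hT.len hab
  obtain ⟨e, f, hf, hv⟩ := hT.exists_flipTo_of_apex hm hab h1 h2 hav hvb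
  exact ⟨a, b, e, f, ⟨hf, hab'⟩, hv, intCast_ne_of_lt h1 (by omega),
    Or.inl (intCast_ne_of_lt h2 (by omega)).symm⟩

theorem exists_gain_of_start (hT : IsPTriangulation m T) (hT' : IsPTriangulation m T')
    (hm : 2 ≤ m) {v b f : ℤ} (hb : Edge m T' v b) (hbm : b ≤ v + m) (hf : Lift m T v f)
    (hf' : ¬ Lift m T' v f) (hfb : f < b) :
    ∃ a b e f : ℤ, DiffFlip m T' T a b e f ∧ Gains m v a b e f := by
  have hlen := hT.len hf
  obtain ⟨f₂, ⟨k1, k2⟩, k3⟩ := Int.exists_least_of_bdd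
    (P := fun z => f < z ∧ Edge m T' v z) ⟨f, fun z hz => by omega⟩ ⟨b, hfb, hb⟩
  have hf₂b := k3 b ⟨hfb, hb⟩
  have hl := k2.lift (by omega)
  obtain ⟨f₁, l1, l2, l3, l4⟩ := hT'.exists_apex hm hl
  have hle : f₁ ≤ f := by
    by_contra hlt
    have := k3 f₁ ⟨by omega, l3⟩
    omega
  have hne : f₁ ≠ f := by
    rintro rfl
    exact hf' (l3.lift hlen.1)
  have hy := l4.lift (by omega)
  obtain ⟨t, t1, t2, t3, t4⟩ := hT'.exists_apex hm hy
  exact ⟨f₁, f₂, v, t, ⟨hT'.flipTo_left hm hy hl l3 t3 t4 l1 t1 t2,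
    fun hc => hT.noncrossing hm hf hc l1 (by omega) k1⟩, Or.inl rfl,
    (intCast_ne_of_lt l1 (by omega)).symm, Or.inr rfl⟩

theorem exists_gain_of_end (hT : IsPTriangulation m T) (hT' : IsPTriangulation m T')
    (hm : 2 ≤ m) {v a e : ℤ} (ha : Edge m T' a v) (ham : v < a + m) (he : Lift m T e v)
    (he' : ¬ Lift m T' e v) (hae : a < e) :
    ∃ a b e f : ℤ, DiffFlip m T' T a b e f ∧ Gains m v a b e f := by
  have hlen := hT.len he
  obtain ⟨f₁, ⟨k1, k2⟩, k3⟩ := Int.exists_greatest_of_bdd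
    (P := fun z => z < e ∧ Edge m T' z v) ⟨e, fun z hz => by omega⟩ ⟨a, hae, ha⟩
  have hf₁a := k3 a ⟨hae, ha⟩
  have hl := k2.lift (by omega)
  obtain ⟨f₂, l1, l2, l3, l4⟩ := hT'.exists_apex hm hl
  have hle : e ≤ f₂ := by
    by_contra hlt
    have := k3 f₂ ⟨by omega, l4⟩
    omega
  have hne : f₂ ≠ e := by
    rintro rfl
    exact he' (l4.lift hlen.1)
  have hy := l3.lift (by omega)
  obtain ⟨t, t1, t2, t3, t4⟩ := hT'.exists_apex hm hy
  exact ⟨f₁, f₂, t, v, ⟨hT'.flipTo_right hm hy hl t3 t4 l4 t1 t2 l2,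
    fun hc => hT.noncrossing hm hc he k1 (by omega) l2⟩, Or.inr rfl,
    intCast_ne_of_lt (by omega) (by omega), Or.inl (intCast_ne_of_lt l2 (by omega))⟩

theorem exists_gain_of_maximal_of_not (hT : IsPTriangulation m T) (hT' : IsPTriangulation m T')
    (hm : 2 ≤ m) {v : ℤ} (hv : ¬ Lift m T v (v + m)) (hv' : Lift m T' v (v + m)) :
    ∃ a b e f : ℤ, DiffFlip m T T' a b e f ∧ Gains m v a b e f := by
  obtain ⟨a, b, hab, h1, h2, h3, h4⟩ := hT.exists_arc_of_apex hm hv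
  exact exists_gain_of_apex hT hm hab (fun hc => hT'.maximal_noncrossing hm hv' hc h1 h2)
    h1 h2 h3 h4

theorem exists_gain_of_apex_lt (hT : IsPTriangulation m T) (hT' : IsPTriangulation m T')
    (hm : 2 ≤ m) {v s s' : ℤ} (hv : Lift m T v (v + m)) (hs : Edge m T v s)
    (hs₂ : Edge m T s (v + m)) (hs' : Edge m T' v s') (h1 : v < s) (h2 : s < s')
    (h3 : s' < v + m) :
    ∃ a b e f : ℤ, DiffFlip m T T' a b e f ∧ Gains m v a b e f := by
  have hz := hs₂.lift (by omega)
  obtain ⟨t, t1, t2, t3, t4⟩ := hT.exists_apex hm hz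
  exact ⟨s, v + m, v, t, ⟨hT.flipTo_left hm hz hv hs t3 t4 h1 t1 t2,
    fun hc => hT'.noncrossing hm (hs'.lift (by omega)) hc h1 h2 h3⟩, Or.inl rfl,
    (intCast_ne_of_lt h1 (by omega)).symm, Or.inr rfl⟩

theorem exists_gain_of_edges (hT : IsPTriangulation m T) (hT' : IsPTriangulation m T')
    (hm : 2 ≤ m) {a v b : ℤ} (hab : Lift m T a b) (h1 : a < v) (h2 : v < b)
    (ha' : Edge m T' a v) (hb' : Edge m T' v b)
    (hx : (∃ f, Lift m T v f ∧ ¬ Lift m T' v f) ∨ ∃ e, Lift m T e v ∧ ¬ Lift m T' e v) :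
    ∃ a b e f : ℤ, DiffFlip m T' T a b e f ∧ Gains m v a b e f := by
  have hlen := hT.len hab
  rcases hx with ⟨f, hf, hf'⟩ | ⟨e, he, he'⟩
  · have hlf := hT.len hf
    refine exists_gain_of_start hT hT' hm hb' (by omega) hf hf' ?_
    rcases lt_trichotomy f b with hlt | rfl | hlt
    · exact hlt
    · exact (hf' (hb'.lift hlf.1)).elim
    · exact (hT.noncrossing hm hab hf h1 h2 hlt).elim
  · have hle := hT.len he
    refine exists_gain_of_end hT hT' hm ha' (by omega) he he' ?_
    rcases lt_trichotomy a e with hlt | rfl | hlt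
    · exact hlt
    · exact (he' (ha'.lift hle.1)).elim
    · exact (hT.noncrossing hm he hab hlt h1 h2).elim

/-- If some arc at `v` lies in `T` but not in `T'`, then `T` or `T'` has a flip gaining at `v` and
removing an arc outside `T ∩ T'`. -/
theorem exists_gain (hT : IsPTriangulation m T) (hT' : IsPTriangulation m T') (hm : 2 ≤ m)
    {v : ℤ} (hx : (∃ f, Lift m T v f ∧ ¬ Lift m T' v f) ∨ ∃ e, Lift m T e v ∧ ¬ Lift m T' e v) :
    ∃ a b e f : ℤ, (DiffFlip m T T' a b e f ∨ DiffFlip m T' T a b e f) ∧ Gains m v a b e f := by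
  have left : (∃ a b e f : ℤ, DiffFlip m T T' a b e f ∧ Gains m v a b e f) →
      ∃ a b e f : ℤ, (DiffFlip m T T' a b e f ∨ DiffFlip m T' T a b e f) ∧ Gains m v a b e f :=
    fun ⟨a, b, e, f, h1, h2⟩ => ⟨a, b, e, f, Or.inl h1, h2⟩
  have right : (∃ a b e f : ℤ, DiffFlip m T' T a b e f ∧ Gains m v a b e f) →
      ∃ a b e f : ℤ, (DiffFlip m T T' a b e f ∨ DiffFlip m T' T a b e f) ∧ Gains m v a b e f :=
    fun ⟨a, b, e, f, h1, h2⟩ => ⟨a, b, e, f, Or.inr h1, h2⟩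
  by_cases hv : Lift m T v (v + m) <;> by_cases hv' : Lift m T' v (v + m)
  · obtain ⟨s, h1, h2, h3, h4⟩ := hT.exists_apex hm hv
    obtain ⟨s', h1', h2', h3', h4'⟩ := hT'.exists_apex hm hv'
    rcases lt_trichotomy s s' with hlt | rfl | hlt
    · exact left (exists_gain_of_apex_lt hT hT' hm hv h3 h4 h3' h1 hlt h2')
    · have h5' : Edge m T' (s - m) v := by
        have := (edge_add hm (-1)).2 h4'
        rwa [show s + -1 * (m : ℤ) = s - m by ring, show v + m + -1 * (m : ℤ) = v by ring] at this
      rcases hx with ⟨f, hf, hf'⟩ | ⟨e, he, he'⟩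
      · have hlf := hT.len hf
        refine right (exists_gain_of_start hT hT' hm h3' h2.le hf hf' ?_)
        rcases lt_trichotomy f s with hlt | rfl | hlt
        · exact hlt
        · exact (hf' (h3'.lift hlf.1)).elim
        · rcases lt_or_eq_of_le hlf.2 with hlt' | rfl
          · exact (hT.edge_noncrossing hm (Or.inr hf) h4 h1 hlt hlt').elim
          · exact (hf' hv').elim
      · have hle := hT.len he
        refine right (exists_gain_of_end hT hT' hm h5' (by omega) he he' ?_)
        rcases lt_trichotomy (s - m) e with hlt | rfl | hlt
        · exact hlt
        · exact (he' (h5'.lift hle.1)).elim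
        · rcases lt_or_eq_of_le hle.2 with hlt' | rfl
          · have := (lift_add hm 1).2 he
            exact (hT.edge_noncrossing hm h3 (Or.inr this) (by omega) (by omega) (by omega)).elim
          · have := (lift_add hm (-1)).2 hv'
            exact (he' (this.of_eq (by omega) (by omega))).elim
    · exact right (exists_gain_of_apex_lt hT' hT hm hv' h3' h4' h3 h1' hlt h2)
  · exact right (exists_gain_of_maximal_of_not hT' hT hm hv' hv)
  · exact left (exists_gain_of_maximal_of_not hT hT' hm hv hv')
  · obtain ⟨a, b, hab, h1, h2, h3, h4⟩ := hT.exists_arc_of_apex hm hv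
    obtain ⟨a', b', hab', h1', h2', h3', h4'⟩ := hT'.exists_arc_of_apex hm hv'
    by_cases k : Lift m T' a b
    · by_cases k' : Lift m T a' b'
      · have e1 := hT.edge_noncrossing hm h3 (Or.inr k')
        have e2 := hT.edge_noncrossing hm (Or.inr k') h4
        have e3 := hT'.edge_noncrossing hm h3' (Or.inr k)
        have e4 := hT'.edge_noncrossing hm (Or.inr k) h4'
        obtain rfl : a = a' := by
          rcases lt_trichotomy a a' with hlt | he | hlt
          · exact (e1 hlt h1' h2').elim
          · exact he
          · exact (e3 hlt h1 h2).elim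
        obtain rfl : b = b' := by
          rcases lt_trichotomy b b' with hlt | he | hlt
          · exact (e4 h1 h2 hlt).elim
          · exact he
          · exact (e2 h1' h2' hlt).elim
        exact right (exists_gain_of_edges hT hT' hm hab h1 h2 h3' h4' hx)
      · exact right (exists_gain_of_apex hT' hm hab' k' h1' h2' h3' h4')
    · exact left (exists_gain_of_apex hT hm hab k h1 h2 h3 h4)

end Flips

section Shelling

variable {m : ℕ} {T T' : Finset (ℤ × ℤ)}

/-- The weight of an arc for a weight function on vertices; starting points count more. -/
def arcWeight (m : ℕ) (w : ZMod m → ℕ) (p : ℤ × ℤ) : ℕ :=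
  3 * w (p.1 : ZMod m) + 2 * w (p.2 : ZMod m)

theorem intCast_canon_fst (a b : ℤ) : (((canon m (a, b)).1 : ℤ) : ZMod m) = a := by
  simp [canon]

theorem intCast_canon_snd (a b : ℤ) : (((canon m (a, b)).2 : ℤ) : ZMod m) = b := by
  simp [canon]

theorem arcWeight_canon (w : ZMod m → ℕ) (a b : ℤ) :
    arcWeight m w (canon m (a, b)) = 3 * w a + 2 * w b := by
  simp only [arcWeight, intCast_canon_fst, intCast_canon_snd]

theorem permitted_canon {c : ZMod m → Bool} {a b : ℤ} :
    Permitted m c (canon m (a, b)) ↔ c a = true ∨ c b = true := by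
  simp only [Permitted, intCast_canon_fst, intCast_canon_snd]

/-- There is a rapidly growing weight function on vertices for which blue outweighs red. -/
theorem exists_vertexWeight (hm : 2 ≤ m) (c : ZMod m → Bool) :
    ∃ w : ZMod m → ℕ, (∀ v, 0 < w v) ∧ (∀ u v, u ≠ v → w u ≤ w v → 4 * w u ≤ w v) ∧
      ∀ u v, c u = true → w u ≤ w v → c v = true := by
  have : NeZero m := ⟨by omega⟩
  set r : ZMod m → ℕ := fun v => v.val + if c v then m else 0 with hr
  have hle : ∀ u v, 4 ^ r u ≤ 4 ^ r v ↔ r u ≤ r v := fun u v =>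
    Nat.pow_le_pow_iff_right (by norm_num)
  have hb : ∀ u v, c u = true → r u ≤ r v → c v = true := by
    intro u v hu huv
    by_contra hv
    have := ZMod.val_lt v
    simp only [hr, hu, hv, if_true] at huv
    simp at huv
    omega
  refine ⟨fun v => 4 ^ r v, fun v => by positivity, fun u v huv h => ?_, fun u v hu h => ?_⟩
  · have hlt : r u < r v := by
      refine lt_of_le_of_ne ((hle u v).1 h) fun he => huv (ZMod.val_injective m ?_)
      have h1 := hb u v
      have h2 := hb v u
      simp only [hr] at he h1 h2
      cases hu : c u <;> cases hv : c v <;> simp_all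
    calc 4 * 4 ^ r u = 4 ^ (r u + 1) := by ring
      _ ≤ 4 ^ r v := Nat.pow_le_pow_right (by norm_num) hlt
  · exact hb u v hu ((hle u v).1 h)

theorem Gains.weight_lt {w : ZMod m → ℕ} (hpos : ∀ v, 0 < w v)
    (hw : ∀ u v, u ≠ v → w u ≤ w v → 4 * w u ≤ w v) {v : ZMod m} {a b e f : ℤ}
    (h : Gains m v a b e f) (ha : w a ≤ w v) (hb : w b ≤ w v) :
    3 * w a + 2 * w b < 3 * w e + 2 * w f := by
  obtain ⟨h1, h2, h3⟩ := h
  have ka := hw _ _ h2 ha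
  have := hpos v
  rcases h3 with h3 | h3
  · have kb := hw _ _ h3 hb
    rcases h1 with h1 | h1 <;> rw [h1] <;> omega
  · rw [h3]
    omega

theorem exists_diffFlip (hT : IsPTriangulation m T) (hT' : IsPTriangulation m T') (hm : 2 ≤ m)
    (hne : T ≠ T') : ∃ a b e f, DiffFlip m T T' a b e f := by
  have hsub : ¬ T ⊆ T' := fun hs => hne (Finset.eq_of_subset_of_card_le hs (by rw [hT.1, hT'.1]))
  obtain ⟨p, hp, hp'⟩ := Finset.not_subset.1 hsub
  have hl := lift_of_mem hT hp
  obtain ⟨c, h1, h2, h3, h4⟩ := hT.exists_apex hm hl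
  obtain ⟨e, f, hf, -⟩ := hT.exists_flipTo_of_apex hm hl h1 h2 h3 h4
  refine ⟨p.1, p.2, e, f, hf, fun hc => hp' ?_⟩
  rwa [Lift, Prod.mk.eta, canon_of_isPArc (hT.2.1 p hp)] at hc

/-- If `v` is a vertex of the quadrilateral of a flip of `T` removing an arc outside `T'`, then
`T` or `T'` has a flip gaining at `v` and removing an arc outside `T ∩ T'`. -/
theorem DiffFlip.exists_gain (hT : IsPTriangulation m T) (hT' : IsPTriangulation m T')
    (hm : 2 ≤ m) {a b e f : ℤ} (h : DiffFlip m T T' a b e f) {v : ZMod m}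
    (hv : v = a ∨ v = b ∨ v = e ∨ v = f) :
    ∃ a b e f : ℤ, (DiffFlip m T T' a b e f ∨ DiffFlip m T' T a b e f) ∧ Gains m v a b e f := by
  by_cases ha : (a : ZMod m) = v
  · subst ha
    exact Punc.exists_gain hT hT' hm (Or.inl ⟨b, h.1.mem, h.2⟩)
  by_cases hb : (b : ZMod m) = v
  · subst hb
    exact Punc.exists_gain hT hT' hm (Or.inr ⟨a, h.1.mem, h.2⟩)
  refine ⟨a, b, e, f, Or.inl h, ?_, ha, Or.inl hb⟩
  rcases hv with hv | hv | hv | hv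
  · exact (ha hv.symm).elim
  · exact (hb hv.symm).elim
  · exact Or.inl hv.symm
  · exact Or.inr hv.symm

/-- Of two distinct permissible triangulations, one has a permissible flip that increases the
weight and removes an arc not contained in the other. -/
theorem exists_improving_flip (hm : 2 ≤ m) {c : ZMod m → Bool} {w : ZMod m → ℕ}
    (hpos : ∀ v, 0 < w v) (hw : ∀ u v, u ≠ v → w u ≤ w v → 4 * w u ≤ w v)
    (hc : ∀ u v, c u = true → w u ≤ w v → c v = true)
    (hT : IsPermissible m c T) (hT' : IsPermissible m c T') (hne : T ≠ T') :
    ∃ p q, arcWeight m w p < arcWeight m w q ∧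
      ((p ∈ T ∧ p ∉ T' ∧ q ∉ T ∧ IsPermissible m c (insert q (T.erase p))) ∨
        (p ∈ T' ∧ p ∉ T ∧ q ∉ T' ∧ IsPermissible m c (insert q (T'.erase p)))) := by
  classical
  have : NeZero m := ⟨by omega⟩
  set S : Finset (ZMod m) := Finset.univ.filter fun v => ∃ a b e f : ℤ,
    (DiffFlip m T T' a b e f ∨ DiffFlip m T' T a b e f) ∧
      (v = a ∨ v = b ∨ v = e ∨ v = f) with hS
  have hSne : S.Nonempty := by
    obtain ⟨a, b, e, f, h⟩ := exists_diffFlip hT.1 hT'.1 hm hne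
    exact ⟨a, by simp only [hS, Finset.mem_filter]; exact
      ⟨Finset.mem_univ _, a, b, e, f, Or.inl h, Or.inl rfl⟩⟩
  obtain ⟨v, hv, hmax⟩ := S.exists_max_image w hSne
  have hgain : ∃ a b e f : ℤ,
      (DiffFlip m T T' a b e f ∨ DiffFlip m T' T a b e f) ∧ Gains m v a b e f := by
    simp only [hS, Finset.mem_filter] at hv
    obtain ⟨-, a, b, e, f, h | h, hv⟩ := hv
    · exact h.exists_gain hT.1 hT'.1 hm hv
    · obtain ⟨a, b, e, f, h1, h2⟩ := h.exists_gain hT'.1 hT.1 hm hv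
      exact ⟨a, b, e, f, h1.symm, h2⟩
  obtain ⟨a, b, e, f, hd, hg⟩ := hgain
  have hle : ∀ u : ZMod m, (u = a ∨ u = b ∨ u = e ∨ u = f) → w u ≤ w v := fun u hu =>
    hmax u (by simp only [hS, Finset.mem_filter]; exact ⟨Finset.mem_univ _, a, b, e, f, hd, hu⟩)
  have key : ∀ T T' : Finset (ℤ × ℤ), IsPermissible m c T → DiffFlip m T T' a b e f →
      canon m (a, b) ∈ T ∧ canon m (a, b) ∉ T' ∧ canon m (e, f) ∉ T ∧
        IsPermissible m c (insert (canon m (e, f)) (T.erase (canon m (a, b)))) := by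
    intro T T' hT hd
    refine ⟨hd.1.mem, hd.2, hd.1.notMem, hd.1.isPTriangulation hT.1 hm, fun p hp => ?_⟩
    rcases Finset.mem_insert.1 hp with rfl | hp
    · have hcv : c v = true := by
        rcases permitted_canon.1 (hT.2 _ hd.1.mem) with h | h
        · exact hc _ _ h (hle _ (by simp))
        · exact hc _ _ h (hle _ (by simp))
      rw [permitted_canon]
      rcases hg.1 with h | h <;> simp [h, hcv]
    · exact hT.2 p (Finset.mem_of_mem_erase hp)
  refine ⟨canon m (a, b), canon m (e, f), ?_, hd.imp (key T T' hT) (key T' T hT')⟩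
  rw [arcWeight_canon, arcWeight_canon]
  exact hg.weight_lt hpos hw (hle _ (by simp)) (hle _ (by simp))

theorem finite_setOf_isPermissible (m : ℕ) (c : ZMod m → Bool) :
    {T | IsPermissible m c T}.Finite := by
  refine (Finset.finite_toSet
    (Finset.Icc (0 : ℤ) m ×ˢ Finset.Icc (0 : ℤ) (2 * m)).powerset).subset fun T hT => ?_
  rw [Finset.mem_coe, Finset.mem_powerset]
  intro p hp
  obtain ⟨h1, h2, h3, h4⟩ := hT.1.2.1 p hp
  simp only [Finset.mem_product, Finset.mem_Icc]
  omega

/-- A finite type can be enumerated along a function with values in a linear order. -/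
theorem exists_monotone_enumeration {α β : Type*} [Fintype α] [LinearOrder β] (φ : α → β) :
    ∃ e : Fin (Fintype.card α) ≃ α, Monotone (φ ∘ e) :=
  ⟨(Tuple.sort (φ ∘ (Fintype.equivFin α).symm)).trans (Fintype.equivFin α).symm,
    Tuple.monotone_sort (φ ∘ (Fintype.equivFin α).symm)⟩

end Shelling

/-- For any bicolouring of `P*_m` (`m ≥ 2`), there is an enumeration
`T_1, …, T_N` of all permissible triangulations such that for all `j < k` there exists
`i < k` with `|T_i ∩ T_k| = m - 2` and `T_j ∩ T_k ⊆ T_i ∩ T_k` (Wilson's shelling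
property). -/
theorem permitted_complex_shellable (m : ℕ) (hm : 2 ≤ m) (c : ZMod m → Bool)
    (hc : IsBicolouring m c) :
    ∃ N : ℕ, ∃ f : Fin N → Finset (ℤ × ℤ),
      Function.Injective f ∧
      (∀ i, IsPermissible m c (f i)) ∧
      (∀ T, IsPermissible m c T → ∃ i, f i = T) ∧
      ∀ j k : Fin N, j < k →
        ∃ i : Fin N, i < k ∧ (f i ∩ f k).card = m - 2 ∧ f j ∩ f k ⊆ f i ∩ f k := by
  obtain ⟨w, hpos, hw, hcw⟩ := exists_vertexWeight hm c
  have : Fintype {T | IsPermissible m c T} := (finite_setOf_isPermissible m c).fintype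
  obtain ⟨e, he⟩ := exists_monotone_enumeration fun T : {T | IsPermissible m c T} =>
    OrderDual.toDual (∑ p ∈ T.1, arcWeight m w p)
  have hstep : ∀ k p q, arcWeight m w p < arcWeight m w q → p ∈ (e k).1 → q ∉ (e k).1 →
      IsPermissible m c (insert q ((e k).1.erase p)) →
      ∃ i < k, (e i).1 = insert q ((e k).1.erase p) := by
    intro k p q hpq hp hq hperm
    refine ⟨e.symm ⟨_, hperm⟩, ?_, by rw [e.apply_symm_apply]⟩
    by_contra hlt
    have := he (not_lt.1 hlt)
    simp only [Function.comp, e.apply_symm_apply, OrderDual.toDual_le_toDual] at this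
    rw [Finset.sum_insert fun h => hq (Finset.mem_of_mem_erase h),
      ← Finset.add_sum_erase _ _ hp] at this
    omega
  refine ⟨_, fun i => (e i).1, fun i j h => e.injective (Subtype.ext h), fun i => (e i).2,
    fun T hT => ⟨e.symm ⟨T, hT⟩, congrArg Subtype.val (e.apply_symm_apply _)⟩, fun j => ?_⟩
  beta_reduce
  induction j using WellFoundedLT.induction with
  | ind j ih =>
  intro k hjk
  have hne : (e j).1 ≠ (e k).1 := fun h => hjk.ne (e.injective (Subtype.ext h))
  obtain ⟨p, q, hpq, ⟨h1, h2, h3, h4⟩ | ⟨h1, h2, h3, h4⟩⟩ :=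
    exists_improving_flip hm hpos hw hcw (e j).2 (e k).2 hne
  · obtain ⟨i, hi, hei⟩ := hstep j p q hpq h1 h3 h4
    obtain ⟨l, hl, hcard, hsub⟩ := ih i hi k (hi.trans hjk)
    refine ⟨l, hl, hcard, subset_trans (fun x hx => ?_) hsub⟩
    obtain ⟨hxj, hxk⟩ := Finset.mem_inter.1 hx
    rw [Finset.mem_inter, hei]
    exact ⟨Finset.mem_insert_of_mem (Finset.mem_erase.2
      ⟨fun h => h2 (h ▸ hxk), hxj⟩), hxk⟩
  · obtain ⟨i, hi, hei⟩ := hstep k p q hpq h1 h3 h4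
    have hinter : (e i).1 ∩ (e k).1 = (e k).1.erase p := by
      rw [hei, Finset.insert_inter_of_notMem h3, Finset.inter_eq_left]
      exact Finset.erase_subset _ _
    refine ⟨i, hi, ?_, fun x hx => ?_⟩
    · rw [hinter, Finset.card_erase_of_mem h1, (e k).2.1.1]
      omega
    · obtain ⟨hxj, hxk⟩ := Finset.mem_inter.1 hx
      rw [hinter]
      exact Finset.mem_erase.2 ⟨fun h => h2 (h ▸ hxj), hxk⟩

end Punc
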